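/- Let w_1, w_2 be closed words of length k + 1 starting at the letter 1, each containing at least one self-edge, such that (w_1, w_2) is a weak CLT pair. Then wt((w_1, w_2)) ≤ k if k is odd, and wt((w_1, w_2)) ≤ k − 1 if k is even. -/

import Mathlib

/-- The list of edges (unordered pairs of adjacent letters) traversed by the word `w`. -/
def edgeList (w : List ℕ) : List (Sym2 ℕ) :=
  (w.zip w.tail).map fun p => s(p.1, p.2)

/-- The edge set `E_w` of the graph `G_w` of the word `w`. -/
def edgeFinset (w : List ℕ) : Finset (Sym2 ℕ) := (edgeList w).toFinset

/-- The traversal count `N_e^w`: the number of times the walk `w` traverses the edge `e`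
(in either direction). -/
def trav (w : List ℕ) (e : Sym2 ℕ) : ℕ := (edgeList w).count e

/-- The support of a word: the set of letters appearing in it. -/
def wsupp (w : List ℕ) : Finset ℕ := w.toFinset

/-- A word is a closed word starting at the letter `1`: a finite sequence of positive
integers whose first and last letters are both equal to `1`. -/
def IsClosedWordAtOne (w : List ℕ) : Prop :=
  w ≠ [] ∧ w.head? = some 1 ∧ w.getLast? = some 1 ∧ ∀ x ∈ w, 0 < x

/-- `(w₁, w₂)` is a weak CLT pair: both are closed words starting at `1`, every edge of the
combined graph is traversed at least twice in total, and the two words share an edge. -/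
def IsWeakCLTPair (w₁ w₂ : List ℕ) : Prop :=
  IsClosedWordAtOne w₁ ∧ IsClosedWordAtOne w₂ ∧
    (∀ e ∈ edgeFinset w₁ ∪ edgeFinset w₂, 2 ≤ trav w₁ e + trav w₂ e) ∧
    (edgeFinset w₁ ∩ edgeFinset w₂).Nonempty


theorem edgeList_cons_cons (a b : ℕ) (l : List ℕ) :
    edgeList (a :: b :: l) = s(a, b) :: edgeList (b :: l) := rfl

theorem length_edgeList (w : List ℕ) : (edgeList w).length = w.length - 1 := by
  simp [edgeList]

theorem mem_of_mem_edgeList {w : List ℕ} {x y : ℕ} (h : s(x, y) ∈ edgeList w) :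
    x ∈ w ∧ y ∈ w := by
  obtain ⟨⟨a, b⟩, hp, he⟩ := List.mem_map.1 h
  obtain ⟨ha, hb⟩ := List.of_mem_zip hp
  have hb := List.mem_of_mem_tail hb
  rcases Sym2.eq_iff.1 he with ⟨rfl, rfl⟩ | ⟨rfl, rfl⟩
  · exact ⟨ha, hb⟩
  · exact ⟨hb, ha⟩

/-- A property of the first letter that propagates along edges holds for every letter. -/
theorem forall_mem_of_propagates (P : ℕ → Prop) (a : ℕ) (l : List ℕ) (ha : P a)
    (hP : ∀ x y, s(x, y) ∈ edgeList (a :: l) → P x → P y) : ∀ x ∈ a :: l, P x := by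
  induction l generalizing a with
  | nil => simpa using ha
  | cons b l ih =>
    rw [edgeList_cons_cons] at hP
    have hb : P b := hP a b (by simp) ha
    have := ih b hb fun x y hxy => hP x y (List.mem_cons_of_mem _ hxy)
    intro x hx
    rcases List.mem_cons.1 hx with rfl | hx
    · exact ha
    · exact this x hx

/-- If `e` is the only edge of a walk across the cut `P`, then the parity of the number of
traversals of `e` says whether the endpoints of the walk are on the same side. -/
theorem even_count_edgeList_iff (P : ℕ → Prop) (e : Sym2 ℕ) (a : ℕ) (l : List ℕ)
    (hP : ∀ x y, s(x, y) ∈ edgeList (a :: l) → (s(x, y) = e ↔ ¬(P x ↔ P y))) :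
    Even ((edgeList (a :: l)).count e) ↔ (P a ↔ P ((a :: l).getLast (List.cons_ne_nil _ _))) := by
  induction l generalizing a with
  | nil => simp [edgeList]
  | cons b l ih =>
    rw [edgeList_cons_cons] at hP ⊢
    have h1 := hP a b (by simp)
    have h2 := ih b fun x y hxy => hP x y (List.mem_cons_of_mem _ hxy)
    rw [List.getLast_cons (List.cons_ne_nil _ _), List.count_cons]
    by_cases he : s(a, b) = e
    · simp only [he, beq_self_eq_true, if_true, Nat.even_add_one, h2]
      tauto
    · simp only [beq_iff_eq, he, if_false, add_zero, h2]
      tauto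

theorem sum_trav_eq (w : List ℕ) (s : Finset (Sym2 ℕ)) (hs : edgeFinset w ⊆ s) :
    ∑ e ∈ s, trav w e = w.length - 1 := by
  rw [← length_edgeList]
  have := Multiset.sum_count_eq_card (s := s) (m := (edgeList w : Multiset (Sym2 ℕ)))
    fun a ha => hs (List.mem_toFinset.2 (by simpa using ha))
  simpa [trav] using this

theorem trav_pos {w : List ℕ} {e : Sym2 ℕ} (h : e ∈ edgeFinset w) : 0 < trav w e :=
  List.count_pos_iff.2 (List.mem_toFinset.1 h)

/-- The simple graph on the vertex set `V` whose edges are the edges in `E` that are not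
self-edges. -/
def graphOn (V : Finset ℕ) (E : Finset (Sym2 ℕ)) : SimpleGraph V :=
  (SimpleGraph.fromEdgeSet (E : Set (Sym2 ℕ))).comap Subtype.val

theorem graphOn_adj {V : Finset ℕ} {E : Finset (Sym2 ℕ)} {x y : V} :
    (graphOn V E).Adj x y ↔ s(x.1, y.1) ∈ E ∧ x.1 ≠ y.1 := by
  simp [graphOn]

theorem card_edgeSet_graphOn_le (V : Finset ℕ) (E : Finset (Sym2 ℕ)) :
    Nat.card (graphOn V E).edgeSet ≤ (E.filter fun e => ¬ e.IsDiag).card := by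
  have hmem : ∀ e : (graphOn V E).edgeSet,
      Sym2.map Subtype.val e.1 ∈ E.filter fun e => ¬ e.IsDiag := by
    rintro ⟨e, he⟩
    induction e using Sym2.ind with
    | _ x y =>
    obtain ⟨h, hne⟩ := graphOn_adj.1 ((graphOn V E).mem_edgeSet.1 he)
    exact Finset.mem_filter.2 ⟨h, by simpa using hne⟩
  have hle := Nat.card_le_card_of_injective
    (fun e => (⟨_, hmem e⟩ : (E.filter fun e => ¬ e.IsDiag : Finset (Sym2 ℕ))))
    fun e₁ e₂ h => Subtype.ext
      (Sym2.map.injective Subtype.val_injective (congrArg Subtype.val h))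
  rwa [Nat.card_eq_fintype_card (α := (_ : Finset (Sym2 ℕ))), Fintype.card_coe] at hle

/-- In a tree, a closed walk traverses every edge an even number of times. -/
theorem even_trav_of_isTree {V : Finset ℕ} {E : Finset (Sym2 ℕ)} (hT : (graphOn V E).IsTree)
    {w : List ℕ} (hw : IsClosedWordAtOne w) (hV : ∀ x ∈ w, x ∈ V) (hE : edgeFinset w ⊆ E)
    {e : Sym2 ℕ} (he : ¬ e.IsDiag) : Even (trav w e) := by
  by_cases hmem : e ∈ edgeFinset w
  swap
  · rw [trav, List.count_eq_zero_of_not_mem fun h => hmem (List.mem_toFinset.2 h)]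
    exact Even.zero
  induction e using Sym2.ind with
  | _ a b =>
  obtain ⟨haw, hbw⟩ := mem_of_mem_edgeList (List.mem_toFinset.1 hmem)
  have hab : (graphOn V E).Adj ⟨a, hV a haw⟩ ⟨b, hV b hbw⟩ :=
    graphOn_adj.2 ⟨hE hmem, by simpa using he⟩
  have hbr := SimpleGraph.isAcyclic_iff_forall_adj_isBridge.1 hT.isAcyclic hab
  rw [SimpleGraph.isBridge_iff] at hbr
  set G' := (graphOn V E) \ SimpleGraph.fromEdgeSet {s(⟨a, hV a haw⟩, ⟨b, hV b hbw⟩)} with hG'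
  let P : ℕ → Prop := fun x => ∃ h : x ∈ V, G'.Reachable ⟨a, hV a haw⟩ ⟨x, h⟩
  have hPa : P a := ⟨hV a haw, SimpleGraph.Reachable.refl _⟩
  have hPb : ¬ P b := fun ⟨_, h⟩ => hbr h
  obtain ⟨hne, hhead, hlast, -⟩ := hw
  obtain ⟨c, l, rfl⟩ := List.exists_cons_of_ne_nil hne
  refine (even_count_edgeList_iff P s(a, b) c l fun x y hxy => ?_).2 ?_
  · obtain ⟨hx, hy⟩ := mem_of_mem_edgeList hxy
    constructor
    · intro h
      rcases Sym2.eq_iff.1 h with ⟨rfl, rfl⟩ | ⟨rfl, rfl⟩ <;> tauto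
    · intro h
      by_contra hcon
      apply h
      rcases eq_or_ne x y with rfl | hxy'
      · exact Iff.rfl
      have hadj : G'.Adj ⟨x, hV x hx⟩ ⟨y, hV y hy⟩ := by
        rw [hG', SimpleGraph.sdiff_adj]
        refine ⟨graphOn_adj.2 ⟨hE (List.mem_toFinset.2 hxy), hxy'⟩, fun h => hcon ?_⟩
        simpa using (SimpleGraph.fromEdgeSet_adj _).1 h |>.1
      exact ⟨fun ⟨_, h⟩ => ⟨hV y hy, h.trans hadj.reachable⟩,
        fun ⟨_, h⟩ => ⟨hV x hx, h.trans hadj.symm.reachable⟩⟩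
  · rw [List.getLast?_eq_some_getLast (List.cons_ne_nil _ _)] at hlast
    rw [Option.some.inj hlast, Option.some.inj hhead]

theorem reachable_graphOn {V : Finset ℕ} {E : Finset (Sym2 ℕ)} {w : List ℕ}
    (hw : IsClosedWordAtOne w) (hV : ∀ x ∈ w, x ∈ V) (hE : edgeFinset w ⊆ E) (h1 : 1 ∈ V)
    (x : ℕ) (hx : x ∈ w) : (graphOn V E).Reachable ⟨1, h1⟩ ⟨x, hV x hx⟩ := by
  obtain ⟨hne, hhead, -, -⟩ := hw
  obtain ⟨c, l, rfl⟩ := List.exists_cons_of_ne_nil hne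
  obtain rfl : c = 1 := Option.some.inj hhead
  obtain ⟨_, h⟩ := forall_mem_of_propagates
    (fun x => ∃ h : x ∈ V, (graphOn V E).Reachable ⟨1, h1⟩ ⟨x, h⟩) 1 l
    ⟨h1, SimpleGraph.Reachable.refl _⟩ (fun x y hxy ⟨h, hr⟩ => by
      have hy := hV y (mem_of_mem_edgeList hxy).2
      rcases eq_or_ne x y with rfl | hne
      · exact ⟨h, hr⟩
      have hadj : (graphOn V E).Adj ⟨x, h⟩ ⟨y, hy⟩ :=
        graphOn_adj.2 ⟨hE (List.mem_toFinset.2 hxy), hne⟩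
      exact ⟨hy, hr.trans hadj.reachable⟩) x hx
  exact h

/-- **Weight bound for weak CLT pairs of words with self-edges.** If `w₁, w₂` are closed
words of length `k + 1` starting at `1`, each containing at least one self-edge, and
`(w₁, w₂)` is a weak CLT pair, then `wt((w₁, w₂)) ≤ k` when `k` is odd and
`wt((w₁, w₂)) ≤ k - 1` when `k` is even. -/
theorem weak_CLT_pair_selfedge_weight_bound (k : ℕ) (w₁ w₂ : List ℕ)
    (hl₁ : w₁.length = k + 1) (hl₂ : w₂.length = k + 1)
    (hs₁ : ∃ e ∈ edgeFinset w₁, e.IsDiag) (hs₂ : ∃ e ∈ edgeFinset w₂, e.IsDiag)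
    (h : IsWeakCLTPair w₁ w₂) :
    (Odd k → (wsupp w₁ ∪ wsupp w₂).card ≤ k) ∧
    (Even k → (wsupp w₁ ∪ wsupp w₂).card ≤ k - 1) := by
  obtain ⟨hc₁, hc₂, h2, -⟩ := h
  set V := wsupp w₁ ∪ wsupp w₂ with hVdef
  set E := edgeFinset w₁ ∪ edgeFinset w₂ with hEdef
  have hV₁ : ∀ x ∈ w₁, x ∈ V := fun x hx => Finset.mem_union_left _ (List.mem_toFinset.2 hx)
  have hV₂ : ∀ x ∈ w₂, x ∈ V := fun x hx => Finset.mem_union_right _ (List.mem_toFinset.2 hx)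
  have hE₁ : edgeFinset w₁ ⊆ E := Finset.subset_union_left
  have hE₂ : edgeFinset w₂ ⊆ E := Finset.subset_union_right
  have h1 : 1 ∈ V := hV₁ 1 (List.mem_of_mem_head? hc₁.2.1)
  have hconn : (graphOn V E).Connected := by
    rw [SimpleGraph.connected_iff_exists_forall_reachable]
    refine ⟨⟨1, h1⟩, fun ⟨x, hx⟩ => ?_⟩
    rcases Finset.mem_union.1 hx with h | h
    · exact reachable_graphOn hc₁ hV₁ hE₁ h1 x (List.mem_toFinset.1 h)
    · exact reachable_graphOn hc₂ hV₂ hE₂ h1 x (List.mem_toFinset.1 h)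
  have hs₁' := sum_trav_eq w₁ E hE₁
  have hs₂' := sum_trav_eq w₂ E hE₂
  rw [hl₁, Nat.add_sub_cancel] at hs₁'
  rw [hl₂, Nat.add_sub_cancel] at hs₂'
  have hsum : ∑ e ∈ E, (trav w₁ e + trav w₂ e) = 2 * k := by
    rw [Finset.sum_add_distrib, hs₁', hs₂', two_mul]
  have hE2 : E.card * 2 ≤ 2 * k := by
    rw [← hsum, ← smul_eq_mul]
    exact Finset.card_nsmul_le_sum _ _ _ h2
  have hsplit := Finset.card_filter_add_card_filter_not (s := E) fun e => e.IsDiag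
  obtain ⟨e₁, he₁, hd₁⟩ := hs₁
  obtain ⟨e₂, he₂, hd₂⟩ := hs₂
  have hm₁ : e₁ ∈ E.filter fun e => e.IsDiag := Finset.mem_filter.2 ⟨hE₁ he₁, hd₁⟩
  have hm₂ : e₂ ∈ E.filter fun e => e.IsDiag := Finset.mem_filter.2 ⟨hE₂ he₂, hd₂⟩
  have hpos := Finset.card_pos.2 ⟨e₁, hm₁⟩
  have hG := card_edgeSet_graphOn_le V E
  have hcard := hconn.card_vert_le_card_edgeSet_add_one
  have hVc : Nat.card V = V.card := by simp
  refine ⟨fun _ => by omega, fun hk => ?_⟩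
  by_contra hlt
  have hT : (graphOn V E).IsTree := by
    rw [SimpleGraph.isTree_iff_connected_and_card]
    exact ⟨hconn, by omega⟩
  have hD : (E.filter fun e => e.IsDiag).card = 1 := by omega
  obtain rfl : e₁ = e₂ := Finset.card_le_one.1 hD.le _ hm₁ _ hm₂
  have htwo := (Finset.sum_eq_sum_iff_of_le (f := fun _ => 2) h2).1
    (by rw [hsum, Finset.sum_const, smul_eq_mul]; omega) e₁ (hE₁ he₁)
  have hone : trav w₁ e₁ = 1 := by
    have := trav_pos he₁
    have := trav_pos he₂
    omega
  have hEq : E.filter (fun e => e.IsDiag) = {e₁} := by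
    obtain ⟨e, he⟩ := Finset.card_eq_one.1 hD
    rw [he, Finset.mem_singleton] at hm₁
    rw [he, hm₁]
  rw [← Finset.sum_filter_add_sum_filter_not E (fun e => e.IsDiag), hEq, Finset.sum_singleton,
    hone] at hs₁'
  have heven : Even (∑ e ∈ E.filter (fun e => ¬ e.IsDiag), trav w₁ e) :=
    Finset.even_sum _ fun e he => even_trav_of_isTree hT hc₁ hV₁ hE₁ (Finset.mem_filter.1 he).2
  rw [← hs₁', add_comm, Nat.even_add_one] at hk
  exact hk heven
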